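/- arXiv:1506.08655 — 4 statements merged into one kernel-verified Lean document; each statement's English description precedes it below -/
import Mathlib

section
/- If n > 4 is a composite integer that is not a perfect square, then n divides (n-3)!. -/
theorem aux_mul_dvd (a b : ℕ) (ha : 2 ≤ a) (hab : a < b) :
    a * b ∣ Nat.factorial (a * b - 3) := by
  obtain ⟨c, rfl⟩ : ∃ c, b = c + 1 := ⟨b - 1, by omega⟩
  have h1 : a ∣ Nat.factorial c := Nat.dvd_factorial (by omega) (by omega)
  have h2 : a * (c + 1) ∣ Nat.factorial (c + 1) := by
    rw [Nat.factorial_succ, mul_comm a]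
    exact Nat.mul_dvd_mul_left _ h1
  have h3 : 2 * (c + 1) ≤ a * (c + 1) := Nat.mul_le_mul_right _ ha
  exact h2.trans (Nat.factorial_dvd_factorial (by omega))

theorem stmt_3 (n : ℕ) (hn : 4 < n) (hcomp : ¬ Nat.Prime n)
    (hsq : ¬ ∃ m : ℕ, n = m ^ 2) :
    n ∣ Nat.factorial (n - 3) := by
  obtain ⟨a, ⟨b, rfl⟩, ha, hlt⟩ := Nat.exists_dvd_of_not_prime2 (by omega) hcomp
  have hb : 2 ≤ b := by
    by_contra h
    have : b = 0 ∨ b = 1 := by omega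
    rcases this with rfl | rfl <;> simp at hlt
  rcases lt_trichotomy a b with h | h | h
  · exact aux_mul_dvd a b ha h
  · exact absurd ⟨a, by rw [h, sq]⟩ hsq
  · rw [mul_comm]
    exact aux_mul_dvd b a hb h
end

section
/- The statement Φ_4 implies that there are infinitely many positive integers x such that x! + 1 is prime. -/
/-- f(1) = 2, f(2) = 3, and f(n+1) = f(n)! for every n ≥ 2. -/
def f : ℕ → ℕ
  | 0 => 1
  | 1 => 2
  | 2 => 3
  | n + 3 => Nat.factorial (f (n + 2))

/-- The set of solutions in positive integers of a system
`S ⊆ {x_i + 1 = x_k, x_i! = x_k, x_i ∤ x_k : i, k ∈ {1,...,n}}`,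
where the system is described by the three relations `A`, `F`, `D` on indices:
`A i k` means the equation `x_i + 1 = x_k` belongs to the system,
`F i k` means the equation `x_i! = x_k` belongs to the system, and
`D i k` means the condition `x_i ∤ x_k` belongs to the system. -/
def SolutionSet (n : ℕ) (A F D : Fin n → Fin n → Prop) : Set (Fin n → ℕ) :=
  {x | (∀ j, 0 < x j) ∧
       (∀ i k, A i k → x i + 1 = x k) ∧
       (∀ i k, F i k → Nat.factorial (x i) = x k) ∧
       (∀ i k, D i k → ¬ (x i ∣ x k))}

/-- The statement Φ_n: if a system has only finitely many solutions in positive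
integers x_1, ..., x_n, then each such solution satisfies x_1, ..., x_n ≤ f(n). -/
def Phi (n : ℕ) : Prop :=
  ∀ A F D : Fin n → Fin n → Prop,
    (SolutionSet n A F D).Finite →
      ∀ x ∈ SolutionSet n A F D, ∀ j, x j ≤ f n

theorem aux_fact_ne_three (x : ℕ) : Nat.factorial x ≠ 3 := by
  intro h
  rcases Nat.lt_or_ge x 3 with hx | hx
  · interval_cases x <;> simp [Nat.factorial] at h
  · have := Nat.factorial_le hx
    have h3 : Nat.factorial 3 = 6 := rfl
    omega

theorem aux_prime (m : ℕ) (hm : 0 < m) (h3 : m ≠ 3) (h : ¬ (m + 1 ∣ Nat.factorial m)) :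
    Nat.Prime (m + 1) := by
  by_contra hp
  apply h
  obtain ⟨a, b, ha, hb, hab⟩ := (Nat.not_prime_iff_exists_mul_eq (by omega)).1 hp
  have ha2 : 2 ≤ a := by
    rcases a with _ | _ | a
    · simp at hab
    · omega
    · omega
  have hb2 : 2 ≤ b := by
    rcases b with _ | _ | b
    · simp at hab
    · omega
    · omega
  have hle : a + b ≤ m := by
    obtain ⟨c, rfl⟩ := Nat.exists_eq_add_of_le ha2
    obtain ⟨d, rfl⟩ := Nat.exists_eq_add_of_le hb2
    have hcd : c + d ≠ 0 := by
      intro h0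
      have hc : c = 0 := by omega
      have hd : d = 0 := by omega
      subst hc; subst hd
      omega
    have : 1 ≤ c + d := by omega
    nlinarith [Nat.zero_le (c * d)]
  rw [← hab]
  exact ((mul_dvd_mul (Nat.dvd_factorial (by omega) le_rfl)
    (Nat.dvd_factorial (by omega) le_rfl)).trans
    (Nat.factorial_mul_factorial_dvd_factorial_add a b)).trans (Nat.factorial_dvd_factorial hle)

theorem stmt_12 (hPhi : Phi 4) (h11 : Nat.Prime (Nat.factorial 11 + 1)) :
    {x : ℕ | 0 < x ∧ Nat.Prime (Nat.factorial x + 1)}.Infinite := by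
  intro hfin
  let A : Fin 4 → Fin 4 → Prop := fun i k => i = 1 ∧ k = 2
  let F : Fin 4 → Fin 4 → Prop := fun i k => (i = 0 ∧ k = 1) ∨ (i = 1 ∧ k = 3)
  let D : Fin 4 → Fin 4 → Prop := fun i k => i = 2 ∧ k = 3
  have key : (SolutionSet 4 A F D).Finite := by
    refine (hfin.image (fun x : ℕ => (![x, x.factorial, x.factorial + 1,
      x.factorial.factorial] : Fin 4 → ℕ))).subset ?_
    rintro x ⟨hpos, hA, hF, hD⟩
    have h1 := hF 0 1 (Or.inl ⟨rfl, rfl⟩)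
    have h2 := hA 1 2 ⟨rfl, rfl⟩
    have h3 := hF 1 3 (Or.inr ⟨rfl, rfl⟩)
    have h4 := hD 2 3 ⟨rfl, rfl⟩
    refine ⟨x 0, ⟨hpos 0, ?_⟩, ?_⟩
    · refine aux_prime _ (Nat.factorial_pos _) (aux_fact_ne_three _) ?_
      rw [h1, h2, h3]
      exact h4
    · funext j
      fin_cases j
      · rfl
      · exact h1
      · change (x 0).factorial + 1 = x 2
        rw [h1, h2]
      · change (x 0).factorial.factorial = x 3
        rw [h1, h3]
  have e : ∃ N : ℕ, N = Nat.factorial 11 := ⟨_, rfl⟩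
  obtain ⟨N, hN⟩ := e
  have hN0 : 0 < N := hN ▸ Nat.factorial_pos 11
  have hmem : (![11, N, N + 1, N.factorial] : Fin 4 → ℕ) ∈ SolutionSet 4 A F D := by
    refine ⟨?_, ?_, ?_, ?_⟩
    · intro j
      fin_cases j
      · exact Nat.succ_pos 10
      · exact hN0
      · exact Nat.succ_pos N
      · exact Nat.factorial_pos N
    · rintro i k ⟨rfl, rfl⟩
      rfl
    · rintro i k (⟨rfl, rfl⟩ | ⟨rfl, rfl⟩)
      · exact hN.symm
      · rfl
    · rintro i k ⟨rfl, rfl⟩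
      change ¬ (N + 1 ∣ N.factorial)
      rw [← hN] at h11
      rw [h11.dvd_factorial]
      omega
  have hle := hPhi A F D key _ hmem 1
  change N ≤ f 4 at hle
  have hf : f 4 = 720 := by simp [f, Nat.factorial]
  have hN' : N = 39916800 := by rw [hN]; simp [Nat.factorial]
  omega
end

section
/- The statement Φ_6 implies that there are infinitely many primes p such that p! + 1 is also prime. -/
theorem aux_step (n : ℕ) : f (n + 3) = Nat.factorial (f (n + 2)) := by
  simp only [f]

theorem aux_four : f 4 = 720 := by
  have h3 : f 3 = 6 := by
    rw [aux_step 0]; simp only [f]; decide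
  rw [aux_step 1]
  show Nat.factorial (f 3) = 720
  rw [h3]; decide

theorem aux_prime_s14 (n : ℕ) (hn : 2 ≤ n) (h4 : n ≠ 4)
    (h : ¬ n ∣ Nat.factorial (n - 1)) : Nat.Prime n := by
  by_contra hp
  obtain ⟨a, b, ha, hb, hab⟩ : ∃ a b : ℕ, 2 ≤ a ∧ 2 ≤ b ∧ n = a * b := by
    obtain ⟨a, ⟨b, hab⟩, ha, han⟩ := Nat.exists_dvd_of_not_prime2 hn hp
    refine ⟨a, b, ha, ?_, hab⟩
    by_contra hb
    have : b = 0 ∨ b = 1 := by omega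
    rcases this with rfl | rfl <;> omega
  apply h
  have hsum : a + b ≤ n - 1 := by
    have : a + b + 1 ≤ n := by
      rcases Nat.lt_or_ge 2 a with h2 | h2
      · nlinarith
      · have : a = 2 := by omega
        subst this
        omega
    omega
  calc n = a * b := hab
    _ ∣ Nat.factorial a * Nat.factorial b :=
      Nat.mul_dvd_mul (Nat.dvd_factorial (by omega) le_rfl) (Nat.dvd_factorial (by omega) le_rfl)
    _ ∣ Nat.factorial (a + b) := Nat.factorial_mul_factorial_dvd_factorial_add a b
    _ ∣ Nat.factorial (n - 1) := Nat.factorial_dvd_factorial hsum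

theorem aux_not_dvd (p : ℕ) (hp : Nat.Prime (p + 1)) : ¬ (p + 1) ∣ Nat.factorial p := by
  rw [hp.dvd_factorial]; omega

def relA (i k : Fin 6) : Prop := (i = 0 ∧ k = 1) ∨ (i = 3 ∧ k = 4)
def relF (i k : Fin 6) : Prop := (i = 0 ∧ k = 2) ∨ (i = 1 ∧ k = 3) ∨ (i = 3 ∧ k = 5)
def relD (i k : Fin 6) : Prop := (i = 1 ∧ k = 2) ∨ (i = 4 ∧ k = 5)

theorem aux_sol (x : Fin 6 → ℕ) (hx : x ∈ SolutionSet 6 relA relF relD) :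
    0 < x 0 ∧ x 0 + 1 = x 1 ∧ x 3 + 1 = x 4 ∧ (x 0).factorial = x 2 ∧ (x 1).factorial = x 3 ∧
    (x 3).factorial = x 5 ∧ ¬ x 1 ∣ x 2 ∧ ¬ x 4 ∣ x 5 := by
  obtain ⟨h0, hA, hF, hD⟩ := hx
  exact ⟨h0 0, hA _ _ (Or.inl ⟨rfl, rfl⟩), hA _ _ (Or.inr ⟨rfl, rfl⟩), hF _ _ (Or.inl ⟨rfl, rfl⟩),
    hF _ _ (Or.inr (Or.inl ⟨rfl, rfl⟩)), hF _ _ (Or.inr (Or.inr ⟨rfl, rfl⟩)),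
    hD _ _ (Or.inl ⟨rfl, rfl⟩), hD _ _ (Or.inr ⟨rfl, rfl⟩)⟩

theorem aux_mem (x : Fin 6 → ℕ) (hx : x ∈ SolutionSet 6 relA relF relD) :
    Nat.Prime (x 1) ∧ Nat.Prime (Nat.factorial (x 1) + 1) := by
  obtain ⟨h0, h01, h34, h02, h13, h35, d1, d2⟩ := aux_sol x hx
  have p2 : Nat.Prime (Nat.factorial (x 1) + 1) := by
    have hpos := Nat.factorial_pos (x 1)
    apply aux_prime_s14 _ (by omega)
    · intro h
      have h3 : (x 1).factorial = 3 := by omega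
      rcases Nat.lt_or_ge (x 1) 3 with h | h
      · have : x 1 = 2 := by omega
        rw [this] at h3; revert h3; decide
      · have := Nat.factorial_le h
        have h6 : Nat.factorial 3 = 6 := by decide
        omega
    · rwa [Nat.add_sub_cancel, h13, h35, h34]
  refine ⟨?_, p2⟩
  apply aux_prime_s14 _ (by omega)
  · intro h
    rw [h] at p2
    revert p2
    have : Nat.factorial 4 + 1 = 25 := by decide
    rw [this]; norm_num
  · rwa [show x 1 - 1 = x 0 by omega, h02]

theorem aux_main (hPhi : Phi 6) (p : ℕ) (hlt : 720 < p + 1) (h1 : Nat.Prime (p + 1))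
    (h2 : Nat.Prime (Nat.factorial (p + 1) + 1)) :
    {p : ℕ | Nat.Prime p ∧ Nat.Prime (Nat.factorial p + 1)}.Infinite := by
  intro hfin
  have hS : (SolutionSet 6 relA relF relD).Finite := by
    refine Set.Finite.of_injOn (f := fun x => x 1) (fun x hx => aux_mem x hx) ?_ hfin
    intro x hx y hy hxy
    obtain ⟨-, a1, a2, a3, a4, a5, -, -⟩ := aux_sol x hx
    obtain ⟨-, b1, b2, b3, b4, b5, -, -⟩ := aux_sol y hy
    have e1 : x 1 = y 1 := hxy
    have e0 : x 0 = y 0 := by omega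
    have e2 : x 2 = y 2 := by rw [← a3, ← b3, e0]
    have e3 : x 3 = y 3 := by rw [← a4, ← b4, e1]
    have e4 : x 4 = y 4 := by omega
    have e5 : x 5 = y 5 := by rw [← a5, ← b5, e3]
    funext i
    fin_cases i
    · exact e0
    · exact e1
    · exact e2
    · exact e3
    · exact e4
    · exact e5
  have key := hPhi relA relF relD hS
    ![p, p + 1, p.factorial, (p + 1).factorial, (p + 1).factorial + 1,
      ((p + 1).factorial).factorial] ?_ 5
  · have key' : ((p + 1).factorial).factorial ≤ f 6 := key
    have e6 : f 6 = ((Nat.factorial (f 4))).factorial := by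
      rw [aux_step 3, aux_step 2]
    rw [e6, aux_four] at key'
    have l1 : Nat.factorial 720 < (p + 1).factorial :=
      (Nat.factorial_lt (by norm_num)).2 hlt
    have l2 := (Nat.factorial_lt (Nat.factorial_pos 720)).2 l1
    exact absurd key' (not_le.2 l2)
  · refine ⟨?_, ?_, ?_, ?_⟩
    · intro j
      fin_cases j
      · show 0 < p
        omega
      · exact Nat.succ_pos p
      · exact Nat.factorial_pos p
      · exact Nat.factorial_pos (p + 1)
      · exact Nat.succ_pos _
      · exact Nat.factorial_pos _
    · rintro i k (⟨rfl, rfl⟩ | ⟨rfl, rfl⟩) <;> rfl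
    · rintro i k (⟨rfl, rfl⟩ | ⟨rfl, rfl⟩ | ⟨rfl, rfl⟩) <;> rfl
    · rintro i k (⟨rfl, rfl⟩ | ⟨rfl, rfl⟩)
      · exact aux_not_dvd p h1
      · exact aux_not_dvd _ h2

theorem aux_main' (hPhi : Phi 6) (p : ℕ) (hlt : 720 < p) (h1 : Nat.Prime p)
    (h2 : Nat.Prime (Nat.factorial p + 1)) :
    {p : ℕ | Nat.Prime p ∧ Nat.Prime (Nat.factorial p + 1)}.Infinite := by
  obtain ⟨q, rfl⟩ : ∃ q, p = q + 1 := ⟨p - 1, by omega⟩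
  exact aux_main hPhi q hlt h1 h2

theorem stmt_14 (hPhi : Phi 6) (h1 : Nat.Prime 26951)
    (h2 : Nat.Prime (Nat.factorial 26951 + 1)) :
    {p : ℕ | Nat.Prime p ∧ Nat.Prime (Nat.factorial p + 1)}.Infinite :=
  aux_main' hPhi 26951 (by norm_num) h1 h2
end

section
/- The statement Φ_5 implies that there are infinitely many twin primes, i.e., infinitely many primes p such that p + 2 is also prime. -/
theorem aux_dvd {a b m : ℕ} (ha : 0 < a) (hb : 0 < b) (h : a + b ≤ m) :
    a * b ∣ Nat.factorial m :=
  (mul_dvd_mul (Nat.dvd_factorial ha le_rfl) (Nat.dvd_factorial hb le_rfl)).trans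
    ((Nat.factorial_mul_factorial_dvd_factorial_add a b).trans (Nat.factorial_dvd_factorial h))

theorem aux_split {n : ℕ} (h2 : 2 ≤ n) (h : ¬ n.Prime) :
    ∃ a b, 2 ≤ a ∧ 2 ≤ b ∧ n = a * b := by
  obtain ⟨a, b, ha, hb, hn⟩ := (Nat.not_prime_iff_exists_mul_eq h2).1 h
  have h0 : a ≠ 0 := by rintro rfl; omega
  have h1 : a ≠ 1 := by rintro rfl; omega
  have h3 : b ≠ 0 := by rintro rfl; omega
  have h4 : b ≠ 1 := by rintro rfl; omega
  exact ⟨a, b, by omega, by omega, hn.symm⟩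

theorem aux_key {y : ℕ} (hy : 0 < y) (h1 : ¬ (y + 1 ∣ Nat.factorial y))
    (h2 : ¬ (y + 3 ∣ Nat.factorial y)) :
    y + 1 = 2 ∨ (Nat.Prime (y + 1) ∧ Nat.Prime (y + 1 + 2)) := by
  by_cases hy3 : y = 3
  · subst hy3
    exact absurd (by decide) h2
  have hp : Nat.Prime (y + 1) := by
    by_contra hc
    obtain ⟨a, b, ha, hb, hab⟩ := aux_split (by omega) hc
    apply h1
    rw [hab]
    apply aux_dvd (by omega) (by omega)
    obtain ⟨c, rfl⟩ := Nat.exists_eq_add_of_le ha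
    obtain ⟨d, rfl⟩ := Nat.exists_eq_add_of_le hb
    by_contra hlt
    have hcd : c = 0 ∧ d = 0 := by constructor <;> nlinarith
    obtain ⟨rfl, rfl⟩ := hcd
    omega
  rcases hp.eq_two_or_odd with h | hodd
  · exact Or.inl h
  refine Or.inr ⟨hp, ?_⟩
  by_contra hc
  obtain ⟨a, b, ha, hb, hab⟩ := aux_split (by omega) hc
  apply h2
  have e : y + 3 = a * b := by omega
  rw [e]
  have ho : Odd (a * b) := by rw [← e, Nat.odd_iff]; omega
  rw [Nat.odd_mul, Nat.odd_iff, Nat.odd_iff] at ho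
  have ha3 : 3 ≤ a := by omega
  have hb3 : 3 ≤ b := by omega
  apply aux_dvd (by omega) (by omega)
  nlinarith

theorem stmt_15 (hPhi : Phi 5) (h809 : Nat.Prime 809) (h811 : Nat.Prime 811) :
    {p : ℕ | Nat.Prime p ∧ Nat.Prime (p + 2)}.Infinite := by
  intro hfin
  have key := hPhi
    (fun i k => (i = 0 ∧ k = 1) ∨ (i = 1 ∧ k = 2) ∨ (i = 2 ∧ k = 3))
    (fun i k => i = 0 ∧ k = 4)
    (fun i k => (i = 1 ∧ k = 4) ∨ (i = 3 ∧ k = 4)) ?_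
    (![808, 809, 810, 811, Nat.factorial 808]) ?_ 4
  · have h5 : f 5 = Nat.factorial 720 := by
      have h4 : f 4 = 720 := by
        simp only [f]; rfl
      change Nat.factorial (f 4) = _
      rw [h4]
    rw [h5] at key
    have hlt : Nat.factorial 720 < Nat.factorial 808 :=
      (Nat.factorial_lt (by norm_num)).2 (by norm_num)
    exact absurd key (not_le.2 hlt)
  · refine ((hfin.insert 2).image
      (fun p => (![p - 1, p, p + 1, p + 2, Nat.factorial (p - 1)] : Fin 5 → ℕ))).subset ?_
    rintro x ⟨hpos, hA, hF, hD⟩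
    have a1 := hA 0 1 (by simp)
    have a2 := hA 1 2 (by simp)
    have a3 := hA 2 3 (by simp)
    have f1 := hF 0 4 (by simp)
    have d1 := hD 1 4 (by simp)
    have d2 := hD 3 4 (by simp)
    rw [← f1] at d1 d2
    rw [← a1] at d1
    rw [← a3, ← a2, ← a1] at d2
    refine ⟨x 0 + 1, aux_key (hpos 0) d1 d2, ?_⟩
    funext i
    fin_cases i
    · simp
    · simpa using a1
    · simp; omega
    · simp; omega
    · simpa using f1
  · have hd : ∀ q, Nat.Prime q → 808 < q → ¬ (q ∣ Nat.factorial 808) := by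
      intro q hq hlt h
      have := (hq.dvd_factorial).1 h
      omega
    refine ⟨?_, ?_, ?_, ?_⟩
    · intro j
      fin_cases j
      · exact Nat.succ_pos _
      · exact Nat.succ_pos _
      · exact Nat.succ_pos _
      · exact Nat.succ_pos _
      · exact Nat.factorial_pos 808
    · rintro i k (⟨rfl, rfl⟩ | ⟨rfl, rfl⟩ | ⟨rfl, rfl⟩) <;> rfl
    · rintro i k ⟨rfl, rfl⟩
      rfl
    · rintro i k (⟨rfl, rfl⟩ | ⟨rfl, rfl⟩)
      · exact hd 809 h809 (by norm_num)
      · exact hd 811 h811 (by norm_num)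
end
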